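/- Minimax expected-error lower bound via two Gaussians: let η(μ) = μ + c₀ for a fixed constant c₀, and for ν ∈ {-1,+1} let P_ν^{2n} be the 2n-fold product of N(νε, 1). Then for any measurable estimator η̂ : ℝ^{2n} → ℝ, max_ν E_{P_ν^{2n}}|η̂ - η(νε)| ≥ (ε/2)(1 - √(2nε²)) for all ε ∈ (0, 1/√(2n)]; in particular, taking ε = 1/√(8n), the maximum expected error is at least 1/(8√(2n)). -/

import Mathlib

open MeasureTheory ProbabilityTheory

/-- A finite product of probability measures with densities has the product density. -/
lemma pi_withDensity_eq {ι : Type*} [Fintype ι] {α : ι → Type*} [∀ i, MeasurableSpace (α i)]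
    (μ : ∀ i, Measure (α i)) [∀ i, IsProbabilityMeasure (μ i)] {f : ∀ i, α i → ENNReal}
    (hf : ∀ i, Measurable (f i)) [∀ i, SigmaFinite ((μ i).withDensity (f i))] :
    Measure.pi (fun i => (μ i).withDensity (f i)) =
      (Measure.pi μ).withDensity fun x => ∏ i, f i (x i) := by
  refine Measure.pi_eq fun s hs => ?_
  have hm : ∀ i, Measurable ((s i).indicator (f i)) := fun i => (hf i).indicator (hs i)
  have hind : (Set.univ.pi s).indicator (fun x => ∏ i, f i (x i)) =
      fun x => ∏ i, (s i).indicator (f i) (x i) := by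
    classical
    ext x
    by_cases hx : x ∈ Set.univ.pi s
    · rw [Set.indicator_of_mem hx]
      exact Finset.prod_congr rfl fun i _ => (Set.indicator_of_mem (hx i trivial) _).symm
    · rw [Set.indicator_of_notMem hx]
      obtain ⟨i, hi⟩ : ∃ i, x i ∉ s i := by simpa [Set.mem_pi] using hx
      exact (Finset.prod_eq_zero (Finset.mem_univ i) (Set.indicator_of_notMem hi _)).symm
  rw [withDensity_apply _ (MeasurableSet.univ_pi hs),
    ← lintegral_indicator (MeasurableSet.univ_pi hs), hind,
    lintegral_prod_eq_prod_lintegral_of_indepFun Finset.univ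
      (fun i (x : ∀ i, α i) => (s i).indicator (f i) (x i))
      (iIndepFun_pi fun i => (hm i).aemeasurable) fun i => (hm i).comp (measurable_pi_apply i)]
  refine Finset.prod_congr rfl fun i _ => ?_
  rw [withDensity_apply _ (hs i), ← lintegral_indicator (hs i)]
  exact (measurePreserving_eval μ i).lintegral_comp (hm i)

lemma gaussianReal_one_eq_withDensity (a : ℝ) :
    gaussianReal a 1 = (gaussianReal 0 1).withDensity
      fun x => ENNReal.ofReal (Real.exp (a * x - a ^ 2 / 2)) := by
  rw [gaussianReal_of_var_ne_zero a one_ne_zero, gaussianReal_of_var_ne_zero 0 one_ne_zero,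
    ← withDensity_mul _ (measurable_gaussianPDF 0 1) (by fun_prop)]
  congr 1
  ext x
  rw [Pi.mul_apply, gaussianPDF, gaussianPDF, ← ENNReal.ofReal_mul (gaussianPDFReal_nonneg _ _ _),
    gaussianPDFReal, gaussianPDFReal, mul_assoc _ _ (Real.exp (a * x - _)), ← Real.exp_add]
  congr 3
  simp only [NNReal.coe_one]
  ring

lemma pi_gaussianReal_one_eq_withDensity {ι : Type*} [Fintype ι] (a : ℝ) :
    (Measure.pi fun _ : ι => gaussianReal a 1) =
      (Measure.pi fun _ : ι => gaussianReal 0 1).withDensity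
        fun x => ENNReal.ofReal (Real.exp (a * ∑ i, x i - Fintype.card ι * a ^ 2 / 2)) := by
  have hσ : SigmaFinite ((gaussianReal 0 1).withDensity
      fun x => ENNReal.ofReal (Real.exp (a * x - a ^ 2 / 2))) := by
    rw [← gaussianReal_one_eq_withDensity]
    infer_instance
  rw [gaussianReal_one_eq_withDensity a, pi_withDensity_eq _ fun _ => by fun_prop]
  congr 1
  ext x
  rw [← ENNReal.ofReal_prod_of_nonneg fun i _ => (Real.exp_pos _).le, ← Real.exp_sum,
    Finset.sum_sub_distrib, ← Finset.mul_sum]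
  simp [mul_div_assoc]

lemma sq_le_add_sq_div_four_mul {p q b : ℝ} (hp : 0 ≤ p) (hq : 0 ≤ q)
    (hpq : p * q = b ^ 2) : b ^ 2 ≤ p + b ^ 2 / 4 * q := by
  refine (sq_le_sq₀ (by positivity) (by positivity)).1 ?_
  nlinarith [sq_nonneg (p - b ^ 2 / 4 * q)]

/-- Linearized lower bound on two errors with sum at least `2 * ε`, weighted by densities whose
product is `b ^ 2`. -/
lemma two_mul_sq_le_weighted_errors {a a' p q b ε : ℝ} (ha : 0 ≤ a) (ha' : 0 ≤ a')
    (haa : 2 * ε ≤ a + a') (hε : 0 ≤ ε) (hp : 0 ≤ p) (hq : 0 ≤ q)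
    (hpq : p * q = b ^ 2) :
    2 * ε * b ^ 2 ≤ a * p + a' * q + ε * b ^ 2 / 2 * (p + q) := by
  rcases le_total p q with h | h
  · have := sq_le_add_sq_div_four_mul hp hq hpq
    have h1 : 0 ≤ ε * b ^ 2 / 2 * p := by positivity
    nlinarith [mul_le_mul_of_nonneg_left h ha', mul_le_mul_of_nonneg_right haa hp,
      mul_le_mul_of_nonneg_left this hε]
  · have := sq_le_add_sq_div_four_mul hq hp (by rwa [mul_comm])
    have h1 : 0 ≤ ε * b ^ 2 / 2 * q := by positivity
    nlinarith [mul_le_mul_of_nonneg_left h ha, mul_le_mul_of_nonneg_right haa hq,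
      mul_le_mul_of_nonneg_left this hε]

/-- Two-point lower bound for densities whose product is the constant `b ^ 2`. -/
lemma ofReal_le_max_lintegral_of_mul_eq {α : Type*} [MeasurableSpace α] {μ : Measure α}
    [IsProbabilityMeasure μ] {p q f g : α → ℝ} {b ε : ℝ}
    (hp : Measurable p) (hq : Measurable q) (hf : Measurable f) (hg : Measurable g)
    (hp0 : ∀ x, 0 ≤ p x) (hq0 : ∀ x, 0 ≤ q x) (hf0 : ∀ x, 0 ≤ f x) (hg0 : ∀ x, 0 ≤ g x)
    (hfg : ∀ x, 2 * ε ≤ f x + g x) (hε : 0 ≤ ε) (hpq : ∀ x, p x * q x = b ^ 2)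
    (hp1 : ∫⁻ x, ENNReal.ofReal (p x) ∂μ = 1) (hq1 : ∫⁻ x, ENNReal.ofReal (q x) ∂μ = 1) :
    ENNReal.ofReal (ε * b ^ 2 / 2) ≤
      max (∫⁻ x, ENNReal.ofReal (f x) ∂μ.withDensity fun x => ENNReal.ofReal (p x))
        (∫⁻ x, ENNReal.ofReal (g x) ∂μ.withDensity fun x => ENNReal.ofReal (q x)) := by
  rw [lintegral_withDensity_eq_lintegral_mul _ hp.ennreal_ofReal hf.ennreal_ofReal,
    lintegral_withDensity_eq_lintegral_mul _ hq.ennreal_ofReal hg.ennreal_ofReal]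
  simp only [Pi.mul_apply]
  set I := ∫⁻ x, ENNReal.ofReal (p x) * ENNReal.ofReal (f x) ∂μ
  set J := ∫⁻ x, ENNReal.ofReal (q x) * ENNReal.ofReal (g x) ∂μ
  set c := ε * b ^ 2 / 2 with hc
  have hc0 : 0 ≤ c := by positivity
  have key : ENNReal.ofReal (4 * c) ≤ I + J + ENNReal.ofReal c * (1 + 1) := by
    have h : ∫⁻ x, (ENNReal.ofReal (p x) * ENNReal.ofReal (f x)
        + ENNReal.ofReal (q x) * ENNReal.ofReal (g x)
        + ENNReal.ofReal c * (ENNReal.ofReal (p x) + ENNReal.ofReal (q x))) ∂μ =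
        I + J + ENNReal.ofReal c * (1 + 1) := by
      rw [lintegral_add_left (by fun_prop), lintegral_add_left (by fun_prop),
        lintegral_const_mul _ (by fun_prop), lintegral_add_left (by fun_prop), hp1, hq1]
    rw [← h]
    calc ENNReal.ofReal (4 * c) = ∫⁻ _, ENNReal.ofReal (4 * c) ∂μ := by simp
      _ ≤ _ := lintegral_mono fun x => ?_
    have := hp0 x
    have := hq0 x
    have := hf0 x
    have := hg0 x
    rw [← ENNReal.ofReal_mul (hp0 x), ← ENNReal.ofReal_mul (hq0 x),
      ← ENNReal.ofReal_add (hp0 x) (hq0 x), ← ENNReal.ofReal_mul hc0,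
      ← ENNReal.ofReal_add (by positivity) (by positivity),
      ← ENNReal.ofReal_add (by positivity) (by positivity)]
    refine ENNReal.ofReal_le_ofReal ?_
    rw [hc]
    linarith [two_mul_sq_le_weighted_errors (hf0 x) (hg0 x) (hfg x) hε (hp0 x) (hq0 x) (hpq x)]
  by_contra! hlt
  obtain ⟨hI, hJ⟩ := max_lt_iff.1 hlt
  refine absurd key (not_le.2 ?_)
  calc I + J + ENNReal.ofReal c * (1 + 1)
      < ENNReal.ofReal c + ENNReal.ofReal c + ENNReal.ofReal c * (1 + 1) :=
        ENNReal.add_lt_add_right (by finiteness) (ENNReal.add_lt_add hI hJ)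
    _ = ENNReal.ofReal (4 * c) := by
        rw [ENNReal.ofReal_mul (by norm_num)]
        norm_num
        ring

lemma two_point_gaussian_lower_bound {ι : Type*} [Fintype ι] (c₀ : ℝ) {h : (ι → ℝ) → ℝ}
    (hh : Measurable h) {ε : ℝ} (hε : 0 ≤ ε) :
    ENNReal.ofReal (ε / 2 * Real.exp (-(Fintype.card ι * ε ^ 2))) ≤
      max
        (∫⁻ x, ENNReal.ofReal |h x - (ε + c₀)| ∂(Measure.pi fun _ : ι => gaussianReal ε 1))
        (∫⁻ x, ENNReal.ofReal |h x - (-ε + c₀)|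
          ∂(Measure.pi fun _ : ι => gaussianReal (-ε) 1)) := by
  have hone : ∀ a : ℝ, ∫⁻ x : ι → ℝ,
      ENNReal.ofReal (Real.exp (a * ∑ i, x i - Fintype.card ι * a ^ 2 / 2))
        ∂(Measure.pi fun _ : ι => gaussianReal 0 1) = 1 := fun a => by
    rw [← setLIntegral_univ, ← withDensity_apply _ MeasurableSet.univ,
      ← pi_gaussianReal_one_eq_withDensity, measure_univ]
  rw [pi_gaussianReal_one_eq_withDensity ε, pi_gaussianReal_one_eq_withDensity (-ε)]
  have hb : Real.exp (-(Fintype.card ι * ε ^ 2)) =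
      Real.exp (-(Fintype.card ι * ε ^ 2) / 2) ^ 2 := by
    rw [← Real.exp_nat_mul]
    congr 1
    push_cast
    ring
  rw [div_mul_eq_mul_div, hb]
  refine ofReal_le_max_lintegral_of_mul_eq (by fun_prop) (by fun_prop) (by fun_prop) (by fun_prop)
    (fun _ => (Real.exp_pos _).le) (fun _ => (Real.exp_pos _).le) (fun _ => abs_nonneg _)
    (fun _ => abs_nonneg _) (fun x => ?_) hε (fun x => ?_)
    (hone ε) (hone (-ε))
  · linarith [neg_abs_le (h x - (ε + c₀)), le_abs_self (h x - (-ε + c₀))]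
  · rw [← hb, ← Real.exp_add]
    congr 1
    ring

/-- Minimax expected-error lower bound via two Gaussians. Let `η(μ) = μ + c₀`
and `P_ν^{2n}` be the `2n`-fold product of `N(νε, 1)` for `ν ∈ {-1,+1}`. Then
any measurable estimator `η̂ : ℝ^{2n} → ℝ` satisfies
`max_ν E_{P_ν^{2n}} |η̂ - η(νε)| ≥ (ε/2)(1 - √(2nε²))` for `ε ∈ (0, 1/√(2n)]`;
in particular, with `ε = 1/√(8n)`, the maximum expected error is at least
`1/(8√(2n))`. (Expected errors are written as lower Lebesgue integrals to allow
the value `∞`.) -/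
theorem minimax_lower_bound_gaussian (n : ℕ) (hn : 0 < n) (c₀ : ℝ)
    (ηhat : (Fin (2 * n) → ℝ) → ℝ) (hηhat : Measurable ηhat) :
    (∀ ε : ℝ, ε ∈ Set.Ioc (0 : ℝ) (1 / Real.sqrt (2 * n)) →
      ENNReal.ofReal ((ε / 2) * (1 - Real.sqrt (2 * n * ε ^ 2))) ≤
        max
          (∫⁻ x, ENNReal.ofReal |ηhat x - (ε + c₀)|
            ∂(Measure.pi fun _ : Fin (2 * n) => gaussianReal ε 1))
          (∫⁻ x, ENNReal.ofReal |ηhat x - (-ε + c₀)|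
            ∂(Measure.pi fun _ : Fin (2 * n) => gaussianReal (-ε) 1))) ∧
    ENNReal.ofReal (1 / (8 * Real.sqrt (2 * n))) ≤
      max
        (∫⁻ x, ENNReal.ofReal |ηhat x - (1 / Real.sqrt (8 * n) + c₀)|
          ∂(Measure.pi fun _ : Fin (2 * n) =>
            gaussianReal (1 / Real.sqrt (8 * n)) 1))
        (∫⁻ x, ENNReal.ofReal |ηhat x - (-(1 / Real.sqrt (8 * n)) + c₀)|
          ∂(Measure.pi fun _ : Fin (2 * n) =>
            gaussianReal (-(1 / Real.sqrt (8 * n))) 1)) := by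
  have main : ∀ ε : ℝ, ε ∈ Set.Ioc (0 : ℝ) (1 / Real.sqrt (2 * n)) →
      ENNReal.ofReal ((ε / 2) * (1 - Real.sqrt (2 * n * ε ^ 2))) ≤
        max
          (∫⁻ x, ENNReal.ofReal |ηhat x - (ε + c₀)|
            ∂(Measure.pi fun _ : Fin (2 * n) => gaussianReal ε 1))
          (∫⁻ x, ENNReal.ofReal |ηhat x - (-ε + c₀)|
            ∂(Measure.pi fun _ : Fin (2 * n) => gaussianReal (-ε) 1)) := by
    rintro ε ⟨hε, hle⟩
    refine le_trans (ENNReal.ofReal_le_ofReal ?_) (two_point_gaussian_lower_bound c₀ hηhat hε.le)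
    have hsqrt : 0 < Real.sqrt (2 * n) := by positivity
    have hs : Real.sqrt (2 * n * ε ^ 2) ≤ 1 := by
      rw [Real.sqrt_mul (by positivity), Real.sqrt_sq hε.le, mul_comm]
      exact (le_div_iff₀ hsqrt).1 hle
    have hsq : Real.sqrt (2 * n * ε ^ 2) ^ 2 = 2 * n * ε ^ 2 := Real.sq_sqrt (by positivity)
    have hexp := Real.add_one_le_exp (-(2 * n * ε ^ 2))
    rw [Fintype.card_fin]
    push_cast
    gcongr
    nlinarith [Real.sqrt_nonneg (2 * n * ε ^ 2)]
  refine ⟨main, ?_⟩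
  have hn' : (0 : ℝ) < n := by exact_mod_cast hn
  have h8 : Real.sqrt (8 * n) = 2 * Real.sqrt (2 * n) := by
    rw [show (8 * n : ℝ) = 2 ^ 2 * (2 * n) by ring, Real.sqrt_mul (by positivity),
      Real.sqrt_sq (by norm_num)]
  have hsqrt : 0 < Real.sqrt (2 * n) := by positivity
  have hhalf : Real.sqrt (2 * n * (1 / Real.sqrt (8 * n)) ^ 2) = 1 / 2 := by
    rw [Real.sqrt_mul (by positivity), Real.sqrt_sq (by positivity), h8]
    field_simp
  refine le_trans (le_of_eq ?_) (main (1 / Real.sqrt (8 * n)) ⟨by positivity, ?_⟩)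
  · rw [hhalf, h8]
    congr 1
    field_simp
    norm_num
  · rw [h8]
    gcongr
    linarith
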